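/- arXiv:1212.3726 — 5 statements merged into one kernel-verified Lean document; each statement's English description precedes it below -/
import Mathlib

section
/- Let K be an infinite field and S = K[x_1,...,x_n]. Let I ⊆ S be a monomial ideal generated in degree 2 with height g. Then I contains a regular sequence f_1,...,f_g of length g in which each f_i is a product of two linear forms. More precisely, if (x_1,...,x_g) is a minimal prime of I, then there exist linear forms ℓ_1,...,ℓ_g such that x_1ℓ_1,...,x_gℓ_g ∈ I and x_1ℓ_1,...,x_gℓ_g is an S-regular sequence. -/
open MvPolynomial

/-- The height of an ideal: the infimum of heights of primes containing it. -/
noncomputable def idealHeight {R : Type*} [CommRing R] (I : Ideal R) : ℕ∞ :=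
  ⨅ P : {P : PrimeSpectrum R // I ≤ P.asIdeal}, Order.height P.val

/-- A monomial ideal generated in degree 2, i.e. generated by products of two variables. -/
def IsQuadraticMonomialIdeal {K : Type*} [Field K] {n : ℕ}
    (I : Ideal (MvPolynomial (Fin n) K)) : Prop :=
  ∃ E : Set (Fin n × Fin n), I = Ideal.span ((fun e => X e.1 * X e.2) '' E)

open RingTheory.Sequence
open scoped Pointwise

theorem wr_ext {R : Type*} [CommRing R] (rs : List R) :
    ∀ {M₁ M₂ M₃ : Type _} [AddCommGroup M₁] [AddCommGroup M₂] [AddCommGroup M₃]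
    [Module R M₁] [Module R M₂] [Module R M₃] (f : M₁ →ₗ[R] M₂) (h : M₂ →ₗ[R] M₃),
    Function.Injective f → Function.Exact f h → Function.Surjective h →
    IsWeaklyRegular M₁ rs → IsWeaklyRegular M₃ rs → IsWeaklyRegular M₂ rs := by
  induction rs with
  | nil => intros; simp
  | cons r rs ih =>
    intro M₁ M₂ M₃ _ _ _ _ _ _ f h hf he hs h1 h3
    rw [isWeaklyRegular_cons_iff] at h1 h3 ⊢
    refine ⟨isSMulRegular_of_range_eq_ker hf (LinearMap.exact_iff.mp he).symm h1.1 h3.1, ?_⟩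
    refine ih (QuotSMulTop.map r f) (QuotSMulTop.map r h) ?_ ?_ ?_ h1.2 h3.2
    · have h0 : Function.Exact (0 : PUnit →ₗ[R] M₁) f := by
        rw [LinearMap.exact_iff]; simp [LinearMap.ker_eq_bot.mpr hf]
      have := QuotSMulTop.map_first_exact_on_four_term_exact_of_isSMulRegular_last h0 he h3.1
      rw [LinearMap.exact_iff] at this
      rw [← LinearMap.ker_eq_bot, this]
      simp
    · exact QuotSMulTop.map_exact r he hs
    · exact QuotSMulTop.map_surjective r hs

theorem wr_mul_cons {R M : Type*} [CommRing R] [AddCommGroup M] [Module R M] (a b : R)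
    (rs : List R) (ha : IsWeaklyRegular M (a :: rs)) (hb : IsWeaklyRegular M (b :: rs)) :
    IsWeaklyRegular M (a * b :: rs) := by
  rw [isWeaklyRegular_cons_iff] at ha hb ⊢
  refine ⟨ha.1.mul hb.1, ?_⟩
  have h1 : (a • ⊤ : Submodule R M) ≤ ((a * b) • ⊤ : Submodule R M).comap (LinearMap.lsmul R M b) := by
    intro x hx
    obtain ⟨y, -, rfl⟩ := (Submodule.mem_smul_pointwise_iff_exists _ _ _).mp hx
    rw [Submodule.mem_comap, Submodule.mem_smul_pointwise_iff_exists]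
    exact ⟨y, trivial, by rw [LinearMap.lsmul_apply, mul_smul, smul_comm]⟩
  have h2 : ((a * b) • ⊤ : Submodule R M) ≤ (b • ⊤ : Submodule R M).comap LinearMap.id := by
    intro x hx
    obtain ⟨y, -, rfl⟩ := (Submodule.mem_smul_pointwise_iff_exists _ _ _).mp hx
    rw [Submodule.mem_comap, Submodule.mem_smul_pointwise_iff_exists]
    exact ⟨a • y, trivial, by simp [mul_smul, smul_comm a b]⟩
  refine wr_ext rs (M₁ := QuotSMulTop a M) (M₃ := QuotSMulTop b M)
    (Submodule.mapQ _ _ _ h1) (Submodule.mapQ _ _ _ h2) ?_ ?_ ?_ ha.2 hb.2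
  · rw [← LinearMap.ker_eq_bot, LinearMap.ker_eq_bot']
    intro x
    obtain ⟨x, rfl⟩ := Submodule.Quotient.mk_surjective _ x
    rw [Submodule.mapQ_apply, Submodule.Quotient.mk_eq_zero, Submodule.Quotient.mk_eq_zero,
      Submodule.mem_smul_pointwise_iff_exists, Submodule.mem_smul_pointwise_iff_exists]
    rintro ⟨y, -, hy⟩
    refine ⟨y, trivial, hb.1 ?_⟩
    simpa [mul_smul, smul_comm a b] using hy
  · intro x
    obtain ⟨x, rfl⟩ := Submodule.Quotient.mk_surjective _ x
    rw [Submodule.mapQ_apply, Submodule.Quotient.mk_eq_zero,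
      Submodule.mem_smul_pointwise_iff_exists]
    constructor
    · rintro ⟨y, -, hy⟩
      refine ⟨Submodule.Quotient.mk y, ?_⟩
      rw [Submodule.mapQ_apply]
      congr 1
    · rintro ⟨y, hy⟩
      obtain ⟨y, rfl⟩ := Submodule.Quotient.mk_surjective _ y
      rw [Submodule.mapQ_apply, Submodule.Quotient.eq, Submodule.mem_smul_pointwise_iff_exists] at hy
      obtain ⟨z, -, hz⟩ := hy
      refine ⟨y - a • z, trivial, ?_⟩
      simp only [LinearMap.lsmul_apply] at hz
      rw [smul_sub, smul_smul, mul_comm b a, hz]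
      simp
  · intro x
    obtain ⟨x, rfl⟩ := Submodule.Quotient.mk_surjective _ x
    exact ⟨Submodule.Quotient.mk x, by rw [Submodule.mapQ_apply]; rfl⟩

theorem wr_prod {R : Type*} [CommRing R] : ∀ (g : ℕ) (a b : Fin g → R)
    {M : Type _} [AddCommGroup M] [Module R M],
    (∀ c : Fin g → Bool, IsWeaklyRegular M (List.ofFn fun i => if c i then a i else b i)) →
    IsWeaklyRegular M (List.ofFn fun i => a i * b i) := by
  intro g
  induction g with
  | zero => intros; simp
  | succ g ih =>
    intro a b M _ _ H
    have key : ∀ (c₀ : Bool), IsWeaklyRegular M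
        ((if c₀ then a 0 else b 0) :: List.ofFn fun i : Fin g => a i.succ * b i.succ) := by
      intro c₀
      have H' : ∀ c : Fin g → Bool, IsWeaklyRegular M ((if c₀ then a 0 else b 0) ::
          List.ofFn fun i : Fin g => if c i then a i.succ else b i.succ) := by
        intro c
        simpa [List.ofFn_succ] using H (Fin.cons c₀ c)
      rw [isWeaklyRegular_cons_iff]
      refine ⟨((isWeaklyRegular_cons_iff _ _ _).mp (H' fun _ => true)).1, ?_⟩
      exact ih _ _ fun c => ((isWeaklyRegular_cons_iff _ _ _).mp (H' c)).2
    rw [List.ofFn_succ]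
    exact wr_mul_cons _ _ _ (by simpa using key true) (by simpa using key false)

theorem span_X_eq_ker {K σ : Type*} [Field K] (s : Set σ) [DecidablePred (· ∈ s)] :
    Ideal.span (X '' s : Set (MvPolynomial σ K)) =
      RingHom.ker (aeval (fun i => if i ∈ s then 0 else X i) :
        MvPolynomial σ K →ₐ[K] MvPolynomial σ K) := by
  apply le_antisymm
  · rw [Ideal.span_le]
    rintro _ ⟨i, hi, rfl⟩
    simp [RingHom.mem_ker, hi]
  · intro p hp
    have key : ∀ q : MvPolynomial σ K, q - (aeval (fun i => if i ∈ s then 0 else X i) :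
        MvPolynomial σ K →ₐ[K] MvPolynomial σ K) q ∈ Ideal.span (X '' s : Set (MvPolynomial σ K)) := by
      intro q
      induction q using MvPolynomial.induction_on with
      | C a => simp
      | add p q hp hq => 
        rw [map_add, add_sub_add_comm]; exact Ideal.add_mem _ hp hq
      | mul_X p i hp =>
        rw [map_mul, aeval_X]
        split_ifs with h
        · simp only [mul_zero, sub_zero]
          exact Ideal.mul_mem_left _ _ (Ideal.subset_span ⟨i, h, rfl⟩)
        · rw [← sub_mul]; exact Ideal.mul_mem_right _ _ hp
    have := key p
    rw [RingHom.mem_ker] at hp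
    rwa [hp, sub_zero] at this

theorem span_X_prime {K σ : Type*} [Field K] (s : Set σ) :
    (Ideal.span (X '' s : Set (MvPolynomial σ K))).IsPrime := by
  classical
  rw [span_X_eq_ker]
  exact RingHom.ker_isPrime _

theorem X_mem_span_iff {K σ : Type*} [Field K] (s : Set σ) (i : σ) :
    (X i : MvPolynomial σ K) ∈ Ideal.span (X '' s : Set (MvPolynomial σ K)) ↔ i ∈ s := by
  classical
  rw [span_X_eq_ker, RingHom.mem_ker, aeval_X]
  split_ifs with h <;> simp [h]

theorem wr_X {K σ : Type*} [Field K] {g : ℕ} (c : Fin g → σ) (hc : Function.Injective c) :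
    IsWeaklyRegular (MvPolynomial σ K) (List.ofFn fun i => (X (c i) : MvPolynomial σ K)) := by
  refine ⟨fun k hk => ?_⟩
  have hk' : k < g := by simpa using hk
  have e : Ideal.ofList (List.take k (List.ofFn fun i => (X (c i) : MvPolynomial σ K))) =
      Ideal.span (X '' {j | ∃ i : Fin g, i.1 < k ∧ c i = j}) := by
    unfold Ideal.ofList
    congr 1
    ext p
    simp only [Set.mem_ofPred_eq, List.mem_take_iff_getElem, List.getElem_ofFn, List.length_ofFn]
    constructor
    · rintro ⟨i, hi, rfl⟩
      exact ⟨_, ⟨⟨i, by omega⟩, by simp; omega, rfl⟩, rfl⟩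
    · rintro ⟨_, ⟨i, hi, rfl⟩, rfl⟩
      exact ⟨i, by omega, rfl⟩
  rw [isSMulRegular_quotient_iff_mem_of_smul_mem]
  simp only [smul_eq_mul, Ideal.mul_top, e, List.getElem_ofFn]
  intro x hx
  refine ((span_X_prime _).mem_or_mem hx).resolve_left ?_
  rw [X_mem_span_iff]
  rintro ⟨i, hi, h⟩
  have := hc h
  simp [this] at hi

noncomputable def linForm {K σ : Type*} [Field K] [Fintype σ] (v : σ → K) : MvPolynomial σ K :=
  ∑ j, C (v j) * X j

theorem linForm_single {K σ : Type*} [Field K] [Fintype σ] [DecidableEq σ] (i : σ) :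
    linForm (Pi.single i (1 : K)) = X i := by
  simp [linForm, Pi.single_apply]

theorem wr_lin {K σ : Type*} [Field K] [Fintype σ] {g : ℕ} (v : Fin g → σ → K)
    (hv : LinearIndependent K v) :
    IsWeaklyRegular (MvPolynomial σ K) (List.ofFn fun i => linForm (v i)) := by
  classical
  let b := Module.Basis.sumExtend hv
  have : Fintype (Module.Basis.sumExtendIndex hv) := by
    have : Finite (Fin g ⊕ Module.Basis.sumExtendIndex hv) := Module.Finite.finite_basis b
    have : Finite (Module.Basis.sumExtendIndex hv) := 
      Finite.of_injective (Sum.inr : _ → Fin g ⊕ Module.Basis.sumExtendIndex hv) Sum.inr_injective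
    exact Fintype.ofFinite _
  let F : MvPolynomial (Fin g ⊕ Module.Basis.sumExtendIndex hv) K →ₐ[K] MvPolynomial σ K :=
    aeval fun i => linForm (b i)
  let G : MvPolynomial σ K →ₐ[K] MvPolynomial (Fin g ⊕ Module.Basis.sumExtendIndex hv) K :=
    aeval fun j => ∑ i, C (b.repr (Pi.single j 1) i) * X i
  have hGl : ∀ w : σ → K, G (linForm w) = ∑ i, C (b.repr w i) * X i := by
    intro w
    have hw : w = ∑ j, w j • Pi.single j (1 : K) := by
      ext k; simp [Finset.sum_apply, Pi.single_apply]
    conv_rhs => rw [hw]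
    simp only [linForm, map_sum, map_mul, G, aeval_X, algHom_C, algebraMap_eq, map_smul,
      Finsupp.coe_finsetSum, Finset.sum_apply, Finsupp.smul_apply, smul_eq_mul,
      Finset.mul_sum, Finset.sum_mul]
    rw [Finset.sum_comm]
    simp only [mul_assoc]
  have hFl : ∀ u : (Fin g ⊕ Module.Basis.sumExtendIndex hv) → K, 
      F (∑ i, C (u i) * X i) = linForm (∑ i, u i • b i) := by
    intro u
    simp only [linForm, map_sum, map_mul, F, aeval_X, algHom_C, algebraMap_eq, 
      Finset.sum_apply, Pi.smul_apply, smul_eq_mul, Finset.mul_sum, Finset.sum_mul]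
    rw [Finset.sum_comm]
    simp only [mul_assoc]
  let e : MvPolynomial (Fin g ⊕ Module.Basis.sumExtendIndex hv) K ≃ₐ[K] MvPolynomial σ K :=
    AlgEquiv.ofAlgHom F G (by
      ext j : 1
      have : G (X j) = ∑ i, C (b.repr (Pi.single j 1) i) * X i := by simp [G]
      rw [AlgHom.comp_apply, this, hFl, b.sum_repr, linForm_single]; rfl)
     (by
      ext j : 1
      have : F (X j) = linForm (b j) := by simp [F]
      rw [AlgHom.comp_apply, this, hGl]
      simp [Finsupp.single_apply])
  have hX := wr_X (K := K) (fun i : Fin g => (Sum.inl i : Fin g ⊕ Module.Basis.sumExtendIndex hv))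
    Sum.inl_injective
  refine (AddEquiv.isWeaklyRegular_congr (e := e.toAddEquiv) ?_).mp hX
  rw [List.forall₂_iff_get]
  refine ⟨by simp, ?_⟩
  intro i h1 h2 x
  have : F (X (Sum.inl ⟨i, by simpa using h1⟩)) = linForm (v ⟨i, by simpa using h1⟩) := by
    have : b (Sum.inl ⟨i, by simpa using h1⟩) = v ⟨i, by simpa using h1⟩ := by
      simp [b, Module.Basis.sumExtend]; rfl
    simp [F, this]
  simp [e, this]

theorem hall_aux {g n : ℕ} (c : Fin g → Fin n) (hc : Function.Injective c)
    (N : Fin g → Finset (Fin n))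
    (hN : ∀ T : Finset (Fin g), g ≤ (Finset.image c Tᶜ ∪ T.biUnion N).card)
    (A : Fin g → Bool) :
    ∃ m : Fin g → Fin n, Function.Injective m ∧ ∀ i, m i ∈ if A i then {c i} else N i := by
  rw [← Finset.all_card_le_biUnion_card_iff_exists_injective
    (fun i => if A i then {c i} else N i)]
  intro s
  have h1 := hN (s.filter fun i => ¬ A i)
  have h2 : (Finset.image c (s.filter fun i => ¬ A i)ᶜ ∪ (s.filter fun i => ¬ A i).biUnion N) ⊆
      s.biUnion (fun i => if A i then {c i} else N i) ∪ Finset.image c sᶜ := by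
    intro j hj
    simp only [Finset.mem_union, Finset.mem_image, Finset.mem_compl, Finset.mem_filter,
      Finset.mem_biUnion] at hj ⊢
    rcases hj with ⟨i, hi, rfl⟩ | ⟨i, ⟨his, hiA⟩, hj⟩
    · by_cases his : i ∈ s
      · left
        have : A i := by by_contra h; exact hi ⟨his, h⟩
        exact ⟨i, his, by simp [this]⟩
      · exact Or.inr ⟨i, his, rfl⟩
    · left
      exact ⟨i, his, by simpa [hiA] using hj⟩
  have h3 := (Finset.card_le_card h2).trans (Finset.card_union_le _ _)
  rw [Finset.card_image_of_injective _ hc, Finset.card_compl, Fintype.card_fin] at h3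
  have h4 : s.card ≤ g := by simpa using Finset.card_le_univ s
  omega

theorem generic_choice {K : Type*} [Field K] [Infinite K] {g n : ℕ} (c : Fin g → Fin n)
    (hc : Function.Injective c)
    (N : Fin g → Finset (Fin n))
    (hN : ∀ T : Finset (Fin g), g ≤ (Finset.image c Tᶜ ∪ T.biUnion N).card) :
    ∃ a : Fin g → Fin n → K, (∀ i j, j ∉ N i → a i j = 0) ∧
      ∀ A : Fin g → Bool, LinearIndependent K
        (fun i => if A i then Pi.single (c i) (1 : K) else a i) := by
  choose m hm hmN using hall_aux c hc N hN
  let Mt (A : Fin g → Bool) : Matrix (Fin g) (Fin g) (MvPolynomial (Fin g × Fin n) K) :=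
    Matrix.of fun i k => if A i then (if c i = m A k then 1 else 0)
      else (if m A k ∈ N i then X (i, m A k) else 0)
  have hMt : ∀ A i k, Mt A i k = if A i then (if c i = m A k then 1 else 0)
      else (if m A k ∈ N i then X (i, m A k) else 0) := fun A i k => rfl
  have hdet : ∀ A, (Mt A).det ≠ 0 := by
    intro A h0
    have h1 := congrArg (eval (fun p : Fin g × Fin n => if p.2 = m A p.1 then (1 : K) else 0)) h0
    rw [RingHom.map_det, map_zero] at h1
    have h2 : (eval (fun p : Fin g × Fin n => if p.2 = m A p.1 then (1 : K) else 0)).mapMatrix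
        (Mt A) = 1 := by
      ext i k
      have := hmN A i
      rw [RingHom.mapMatrix_apply, Matrix.map_apply, Matrix.one_apply, hMt]
      by_cases hA : A i
      · simp only [hA, if_true, Finset.mem_singleton] at this
        simp only [hA, if_true, ← this, (hm A).eq_iff]
        split_ifs <;> simp
      · simp only [hA] at this
        simp only [hA]
        by_cases hik : i = k
        · subst hik; simp_all
        · have : m A k ≠ m A i := fun h => hik (hm A h).symm
          split_ifs <;> simp_all
    rw [h2, Matrix.det_one] at h1
    exact one_ne_zero h1
  have hprod : ∏ A, (Mt A).det ≠ 0 := Finset.prod_ne_zero_iff.mpr fun A _ => hdet A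
  obtain ⟨x, hx⟩ : ∃ x, eval x (∏ A, (Mt A).det) ≠ 0 := by
    by_contra! h
    exact hprod (MvPolynomial.funext fun x => by rw [h x, map_zero])
  rw [map_prod, Finset.prod_ne_zero_iff] at hx
  refine ⟨fun i j => if j ∈ N i then x (i, j) else 0, fun i j h => by simp [h], fun A => ?_⟩
  have h := hx A (Finset.mem_univ _)
  rw [RingHom.map_det] at h
  have h1 := Matrix.linearIndependent_rows_of_det_ne_zero h
  refine LinearIndependent.of_comp (LinearMap.funLeft K K (m A)) ?_
  have e : (LinearMap.funLeft K K (m A)) ∘ (fun i => if A i then Pi.single (c i) (1 : K) else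
      fun j => if j ∈ N i then x (i, j) else 0) = fun i => (eval x).mapMatrix (Mt A) i := by
    ext i k
    rw [RingHom.mapMatrix_apply, Matrix.map_apply, hMt, Function.comp_apply,
      LinearMap.funLeft_apply]
    by_cases hA : A i
    · simp only [hA, if_true, Pi.single_apply, @eq_comm _ (m A k)]
      split_ifs <;> simp
    · simp only [hA]
      split_ifs <;> simp_all
  rw [e]
  exact h1

theorem card_le_height {K : Type*} [Field K] {n : ℕ} (hp : ∀ s : Set (Fin n), 
    (Ideal.span (X '' s : Set (MvPolynomial (Fin n) K))).IsPrime) 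
    (hX : ∀ (s : Set (Fin n)) (i : Fin n),
    (X i : MvPolynomial (Fin n) K) ∈ Ideal.span (X '' s : Set (MvPolynomial (Fin n) K)) ↔ i ∈ s)
    (s : Finset (Fin n)) :
    (s.card : ℕ∞) ≤ (Ideal.span (X '' (s : Set (Fin n)) : Set (MvPolynomial (Fin n) K))).height := by
  induction s using Finset.induction_on with
  | empty => simp
  | insert i s hi ih =>
    have := hp s
    have := hp (insert i s : Finset _)
    rw [Finset.card_insert_of_notMem hi]
    push_cast
    refine (add_le_add_left ih 1).trans ?_
    have := Ideal.height_add_one_le_of_lt_of_isPrime 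
      (I := Ideal.span (X '' (s : Set (Fin n)) : Set (MvPolynomial (Fin n) K)))
      (J := Ideal.span (X '' ((insert i s : Finset _) : Set (Fin n)) : Set (MvPolynomial (Fin n) K))) ?_
    · simpa using this
    · refine lt_of_le_of_ne (Ideal.span_mono (Set.image_mono (by simp))) fun h => hi ?_
      have h1 := (hX (insert i s : Finset _) i).mpr (by simp)
      rw [← h, hX] at h1
      exact h1

theorem height_le_card' {K : Type*} [Field K] {n : ℕ} (s : Finset (Fin n))
    (hp : (Ideal.span (X '' (s : Set (Fin n)) : Set (MvPolynomial (Fin n) K))).IsPrime) :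
    (Ideal.span (X '' (s : Set (Fin n)) : Set (MvPolynomial (Fin n) K))).height ≤ s.card := by
  classical
  have := Ideal.height_le_card_of_mem_minimalPrimes_span_finset (s := s.image X)
    (p := Ideal.span (X '' (s : Set (Fin n)) : Set (MvPolynomial (Fin n) K))) (by
      rw [Finset.coe_image, Ideal.minimalPrimes_eq_subsingleton_self]; rfl)
  exact this.trans (by exact_mod_cast Finset.card_image_le)
theorem main_aux {K : Type*} [Field K] [Infinite K] {n g : ℕ}
    (I : Ideal (MvPolynomial (Fin n) K)) (E : Set (Fin n × Fin n))
    (hI : I = Ideal.span ((fun e => X e.1 * X e.2) '' E))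
    (c : Fin g → Fin n) (hc : Function.Injective c)
    (hcov : ∀ e ∈ E, (∃ i, c i = e.1) ∨ (∃ i, c i = e.2))
    (hmin : ∀ D : Finset (Fin n), (∀ e ∈ E, e.1 ∈ D ∨ e.2 ∈ D) → g ≤ D.card) :
    ∃ ℓ : Fin g → MvPolynomial (Fin n) K,
        (∀ i, (ℓ i).IsHomogeneous 1) ∧
        (∀ i, X (c i) * ℓ i ∈ I) ∧
        RingTheory.Sequence.IsRegular (MvPolynomial (Fin n) K)
          (List.ofFn fun i => X (c i) * ℓ i) := by
  classical
  let N : Fin g → Finset (Fin n) := fun i =>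
    Finset.univ.filter fun j => (c i, j) ∈ E ∨ (j, c i) ∈ E
  have hN : ∀ T : Finset (Fin g), g ≤ (Finset.image c Tᶜ ∪ T.biUnion N).card := by
    intro T
    apply hmin
    rintro ⟨u, v⟩ he
    simp only [Finset.mem_union, Finset.mem_image, Finset.mem_compl, Finset.mem_biUnion, N,
      Finset.mem_filter, Finset.mem_univ, true_and]
    rcases hcov _ he with ⟨i, hi⟩ | ⟨i, hi⟩
    · simp only at hi
      subst hi
      by_cases hT : i ∈ T
      · exact Or.inr (Or.inr ⟨i, hT, Or.inl he⟩)
      · exact Or.inl (Or.inl ⟨i, hT, rfl⟩)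
    · simp only at hi
      subst hi
      by_cases hT : i ∈ T
      · exact Or.inl (Or.inr ⟨i, hT, Or.inr he⟩)
      · exact Or.inr (Or.inl ⟨i, hT, rfl⟩)
  obtain ⟨a, ha, hA⟩ := generic_choice (K := K) c hc N hN
  have hmem : ∀ i, X (c i) * linForm (a i) ∈ I := by
    intro i
    rw [linForm, Finset.mul_sum]
    refine Ideal.sum_mem _ fun j _ => ?_
    by_cases hj : j ∈ N i
    · have : (X (c i) * X j : MvPolynomial (Fin n) K) ∈ I := by
        rw [hI]
        simp only [N, Finset.mem_filter, Finset.mem_univ, true_and] at hj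
        rcases hj with h | h
        · exact Ideal.subset_span ⟨_, h, rfl⟩
        · exact Ideal.subset_span ⟨_, h, mul_comm _ _⟩
      rw [mul_left_comm]
      exact Ideal.mul_mem_left _ _ this
    · simp [ha i j hj]
  refine ⟨fun i => linForm (a i), fun i => ?_, hmem, ?_, ?_⟩
  · refine IsHomogeneous.sum _ _ _ fun j _ => ?_
    simpa using (isHomogeneous_C (Fin n) (a i j)).mul (isHomogeneous_X K j)
  · apply wr_prod
    intro A
    convert wr_lin _ (hA A) using 3 with i
    split_ifs
    · rw [linForm_single]
    · rfl
  · intro h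
    rw [smul_eq_mul, Ideal.mul_top] at h
    have h1 : I ≤ RingHom.ker (constantCoeff : MvPolynomial (Fin n) K →+* K) := by
      rw [hI, Ideal.span_le]
      rintro _ ⟨e, -, rfl⟩
      simp [RingHom.mem_ker]
    have h2 : Ideal.ofList (List.ofFn fun i => X (c i) * linForm (a i)) ≤ I := by
      unfold Ideal.ofList
      rw [Ideal.span_le]
      intro p hp
      obtain ⟨i, rfl⟩ := (List.mem_ofFn' _ _).mp hp
      exact hmem i
    have h3 : (1 : MvPolynomial (Fin n) K) ∈ RingHom.ker (constantCoeff : MvPolynomial (Fin n) K →+* K) :=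
      h1 (h2 (h ▸ trivial))
    simp [RingHom.mem_ker] at h3

theorem stmt2 {K : Type*} [Field K] [Infinite K] {n g : ℕ} (hgn : g ≤ n)
    (I : Ideal (MvPolynomial (Fin n) K))
    (hmon : IsQuadraticMonomialIdeal I) (hht : idealHeight I = (g : ℕ∞)) :
    (∃ f : Fin g → MvPolynomial (Fin n) K,
      (∀ i, f i ∈ I) ∧
      (∀ i, ∃ l₁ l₂ : MvPolynomial (Fin n) K,
        l₁.IsHomogeneous 1 ∧ l₂.IsHomogeneous 1 ∧ f i = l₁ * l₂) ∧
      RingTheory.Sequence.IsRegular (MvPolynomial (Fin n) K) (List.ofFn f)) ∧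
    (Ideal.span (Set.range fun i : Fin g => (X (Fin.castLE hgn i) : MvPolynomial (Fin n) K)) ∈
        I.minimalPrimes →
      ∃ ℓ : Fin g → MvPolynomial (Fin n) K,
        (∀ i, (ℓ i).IsHomogeneous 1) ∧
        (∀ i, X (Fin.castLE hgn i) * ℓ i ∈ I) ∧
        RingTheory.Sequence.IsRegular (MvPolynomial (Fin n) K)
          (List.ofFn fun i => X (Fin.castLE hgn i) * ℓ i)) := by
  classical
  obtain ⟨E, hE⟩ := hmon
  have hmem : ∀ e ∈ E, (X e.1 * X e.2 : MvPolynomial (Fin n) K) ∈ I := by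
    intro e he
    rw [hE]
    exact Ideal.subset_span ⟨e, he, rfl⟩
  have hmin : ∀ D : Finset (Fin n), (∀ e ∈ E, e.1 ∈ D ∨ e.2 ∈ D) → g ≤ D.card := by
    intro D hD
    have hp := span_X_prime (K := K) (D : Set (Fin n))
    have hle : I ≤ Ideal.span (X '' (D : Set (Fin n)) : Set (MvPolynomial (Fin n) K)) := by
      rw [hE, Ideal.span_le]
      rintro _ ⟨e, he, rfl⟩
      rcases hD e he with h | h
      · exact Ideal.mul_mem_right _ _ (Ideal.subset_span ⟨_, h, rfl⟩)
      · exact Ideal.mul_mem_left _ _ (Ideal.subset_span ⟨_, h, rfl⟩)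
    have h1 : idealHeight I ≤ Order.height (⟨_, hp⟩ : PrimeSpectrum (MvPolynomial (Fin n) K)) :=
      iInf_le (fun P : {P : PrimeSpectrum (MvPolynomial (Fin n) K) // I ≤ P.asIdeal} =>
        Order.height P.val) ⟨⟨_, hp⟩, hle⟩
    rw [hht, ← PrimeSpectrum.height_eq_orderHeight] at h1
    exact_mod_cast h1.trans (height_le_card' D hp)
  constructor
  · obtain ⟨P, hP, hPg⟩ : ∃ P : PrimeSpectrum (MvPolynomial (Fin n) K), I ≤ P.asIdeal ∧
        Order.height P = g := by
      unfold idealHeight at hht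
      rw [ENat.iInf_eq_natCast_iff] at hht
      obtain ⟨⟨⟨P, hP⟩, h⟩, -⟩ := hht
      exact ⟨P, hP, h⟩
    let D : Finset (Fin n) := Finset.univ.filter fun i => X i ∈ P.asIdeal
    have hD : ∀ e ∈ E, e.1 ∈ D ∨ e.2 ∈ D := by
      intro e he
      simpa [D] using P.isPrime.mem_or_mem (hP (hmem e he))
    have hle : Ideal.span (X '' (D : Set (Fin n)) : Set (MvPolynomial (Fin n) K)) ≤ P.asIdeal := by
      rw [Ideal.span_le]
      rintro _ ⟨i, hi, rfl⟩
      simpa [D] using hi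
    have h1 := (card_le_height (K := K) span_X_prime X_mem_span_iff D).trans (Ideal.height_mono hle)
    rw [PrimeSpectrum.height_eq_orderHeight, hPg] at h1
    have hcard : D.card = g := le_antisymm (by exact_mod_cast h1) (hmin D hD)
    obtain ⟨ℓ, h1, h2, h3⟩ := main_aux I E hE (D.orderEmbOfFin hcard)
      (D.orderEmbOfFin hcard).injective (by
        have hr : ∀ j ∈ D, ∃ i, D.orderEmbOfFin hcard i = j := by
          intro j hj
          have : j ∈ Set.range (D.orderEmbOfFin hcard) := by simpa using hj
          exact this
        intro e he
        exact (hD e he).imp (hr _) (hr _)) hmin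
    exact ⟨_, h2, fun i => ⟨_, _, isHomogeneous_X K _, h1 i, rfl⟩, h3⟩
  · intro hm
    refine main_aux I E hE (Fin.castLE hgn) (Fin.castLE_injective hgn) ?_ hmin
    have hle := hm.1.2
    have hr : (Set.range fun i : Fin g => (X (Fin.castLE hgn i) : MvPolynomial (Fin n) K)) =
        X '' (Set.range (Fin.castLE hgn)) := by
      rw [← Set.range_comp]; rfl
    rw [hr] at hle
    intro e he
    have := (span_X_prime _).mem_or_mem (hle (hmem e he))
    rw [X_mem_span_iff, X_mem_span_iff] at this
    exact this
end

section
/- Let K be a field, S = K[x_1,...,x_n], g ≤ n, and let ℓ_1,...,ℓ_g be linear forms in S. Then x_1ℓ_1,...,x_gℓ_g is an S-regular sequence if and only if for every subset A ⊆ {1,...,g} the K-vector space spanned by {x_i : i ∈ A} ∪ {ℓ_j : j ∈ {1,...,g} \ A} has dimension g. -/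
open MvPolynomial

open RingTheory.Sequence Function
open scoped Pointwise

theorem aux_ses {R : Type*} [CommRing R] (rs : List R) :
    ∀ {M M' M'' : Type _} [AddCommGroup M] [AddCommGroup M'] [AddCommGroup M'']
    [Module R M] [Module R M'] [Module R M''] (f : M →ₗ[R] M') (g : M' →ₗ[R] M'')
    (_ : Injective f) (_ : Exact f g) (_ : Surjective g)
    (_ : IsWeaklyRegular M rs) (_ : IsWeaklyRegular M'' rs), IsWeaklyRegular M' rs := by
  induction rs with
  | nil => intros; exact IsWeaklyRegular.nil _ _
  | cons r rs ih =>
    intro M M' M'' _ _ _ _ _ _ f g hf hfg hg h1 h2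
    rw [isWeaklyRegular_cons_iff] at h1 h2 ⊢
    refine ⟨isSMulRegular_of_range_eq_ker hf hfg.linearMap_ker_eq.symm h1.1 h2.1, ?_⟩
    refine ih (QuotSMulTop.map r f) (QuotSMulTop.map r g) ?_ (QuotSMulTop.map_exact r hfg hg)
      (QuotSMulTop.map_surjective r hg) h1.2 h2.2
    have h0 : Exact (0 : M →ₗ[R] M) f := by
      intro x
      constructor
      · intro hx
        have : x = 0 := hf (by simpa using hx)
        exact ⟨0, by simp [this]⟩
      · rintro ⟨y, rfl⟩
        simp
    have h3 := QuotSMulTop.map_first_exact_on_four_term_exact_of_isSMulRegular_last h0 hfg h2.1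
    rw [injective_iff_map_eq_zero]
    intro a ha
    obtain ⟨b, rfl⟩ := (h3 a).1 ha
    simp

theorem aux_prod {R : Type*} [CommRing R] {g : ℕ} :
    ∀ (a b : Fin g → R) {M : Type _} [AddCommGroup M] [Module R M],
    (∀ c : Fin g → R, (∀ i, c i = a i ∨ c i = b i) → IsWeaklyRegular M (List.ofFn c)) →
    IsWeaklyRegular M (List.ofFn fun i => a i * b i) := by
  induction g with
  | zero => intros; simp
  | succ g ih =>
    intro a b M _ _ h
    have key : ∀ x, (x = a 0 ∨ x = b 0) → IsSMulRegular M x ∧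
        IsWeaklyRegular (QuotSMulTop x M) (List.ofFn fun i : Fin g => a i.succ * b i.succ) := by
      intro x hx
      have H : ∀ c : Fin g → R, (∀ i, c i = a i.succ ∨ c i = b i.succ) →
          IsSMulRegular M x ∧ IsWeaklyRegular (QuotSMulTop x M) (List.ofFn c) := by
        intro c hc
        have := h (Fin.cons x c) (by
          intro i
          refine Fin.cases ?_ ?_ i
          · simpa using hx
          · intro i; simpa using hc i)
        rw [List.ofFn_succ, isWeaklyRegular_cons_iff] at this
        exact this
      exact ⟨(H (fun i => a i.succ) (by simp)).1, ih _ _ fun c hc => (H c hc).2⟩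
    obtain ⟨ha, ha'⟩ := key (a 0) (Or.inl rfl)
    obtain ⟨hb, hb'⟩ := key (b 0) (Or.inr rfl)
    rw [List.ofFn_succ, isWeaklyRegular_cons_iff]
    refine ⟨ha.mul hb, ?_⟩
    generalize a 0 = a0 at *
    generalize b 0 = b0 at *
    have hmem : ∀ (r : R) (x : M), x ∈ (r • ⊤ : Submodule R M) ↔ ∃ y, r • y = x := by
      intro r x
      rw [Submodule.mem_smul_pointwise_iff_exists]
      simp
    let f : QuotSMulTop b0 M →ₗ[R] QuotSMulTop (a0 * b0) M :=
      Submodule.mapQ _ _ (LinearMap.lsmul R M a0) (by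
        intro x hx
        obtain ⟨y, rfl⟩ := (hmem _ _).1 hx
        exact (hmem _ _).2 ⟨y, by simp [mul_smul, smul_comm a0 b0 y]⟩)
    let p : QuotSMulTop (a0 * b0) M →ₗ[R] QuotSMulTop a0 M :=
      Submodule.mapQ _ _ LinearMap.id (by
        intro x hx
        obtain ⟨y, rfl⟩ := (hmem _ _).1 hx
        exact (hmem _ _).2 ⟨b0 • y, by simp [mul_smul]⟩)
    have hf : ∀ x : M, f (Submodule.Quotient.mk x) = Submodule.Quotient.mk (a0 • x) :=
      fun _ => rfl
    have hp : ∀ x : M, p (Submodule.Quotient.mk x) = Submodule.Quotient.mk x :=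
      fun _ => rfl
    refine aux_ses _ f p ?_ ?_ ?_ hb' ha'
    · rw [injective_iff_map_eq_zero]
      intro x hx
      obtain ⟨x, rfl⟩ := Submodule.Quotient.mk_surjective _ x
      rw [hf, Submodule.Quotient.mk_eq_zero] at hx
      rw [Submodule.Quotient.mk_eq_zero]
      obtain ⟨y, hy⟩ := (hmem _ _).1 hx
      rw [mul_smul] at hy
      exact (hmem _ _).2 ⟨y, ha hy⟩
    · intro x
      obtain ⟨x, rfl⟩ := Submodule.Quotient.mk_surjective _ x
      rw [hp, Submodule.Quotient.mk_eq_zero, hmem]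
      constructor
      · rintro ⟨y, rfl⟩
        exact ⟨Submodule.Quotient.mk y, hf y⟩
      · rintro ⟨y, hy⟩
        obtain ⟨y, rfl⟩ := Submodule.Quotient.mk_surjective _ y
        rw [hf, Submodule.Quotient.eq, hmem] at hy
        obtain ⟨z, hz⟩ := hy
        refine ⟨y - b0 • z, ?_⟩
        rw [smul_sub, ← mul_smul, hz]; abel
    · intro x
      obtain ⟨x, rfl⟩ := Submodule.Quotient.mk_surjective _ x
      exact ⟨_, hp x⟩

theorem aux_X {K κ : Type*} [Field K] {g : ℕ} (f : Fin g → κ) (hf : Injective f) :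
    IsWeaklyRegular (MvPolynomial κ K) (List.ofFn fun i => (X (f i) : MvPolynomial κ K)) := by
  constructor
  intro i hi
  have hig : i < g := by simpa using hi
  have hI : Ideal.ofList (List.take i (List.ofFn fun i => (X (f i) : MvPolynomial κ K))) =
      Ideal.span (X '' (f '' {j | j.1 < i})) := by
    unfold Ideal.ofList
    congr 1
    ext x
    simp only [List.mem_take_iff_getElem, Set.mem_image, Set.mem_ofPred_eq]
    constructor
    · rintro ⟨j, hj, rfl⟩
      simp only [List.length_ofFn] at hj
      exact ⟨_, ⟨⟨j, by omega⟩, by simp; omega, rfl⟩, by simp⟩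
    · rintro ⟨_, ⟨j, hj, rfl⟩, rfl⟩
      exact ⟨j, by simp; omega, by simp⟩
  rw [isSMulRegular_quotient_iff_mem_of_smul_mem, hI]
  intro x hx
  simp only [smul_eq_mul, Ideal.mul_top, List.getElem_ofFn] at hx ⊢
  rw [mem_ideal_span_X_image] at hx ⊢
  intro m hm
  obtain ⟨k, ⟨j, hj, rfl⟩, hk⟩ := hx (Finsupp.single (f ⟨i, hig⟩) 1 + m) (by
    rw [mem_support_iff] at hm ⊢
    rwa [coeff_X_mul])
  refine ⟨f j, ⟨j, hj, rfl⟩, ?_⟩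
  have : f ⟨i, hig⟩ ≠ f j := fun h => by
    have := hf h
    subst this
    simp at hj
  simpa [Finsupp.single_apply, this] using hk

theorem aux_hom {K : Type*} [Field K] {n : ℕ} (p : MvPolynomial (Fin n) K)
    (hp : p.IsHomogeneous 1) :
    p = ∑ j, coeff (Finsupp.single j 1) p • X j := by
  ext m
  by_cases hm : m.degree = 1
  · obtain ⟨k, rfl⟩ : ∃ k, m = Finsupp.single k 1 := by
      have : m ∈ {d : Fin n →₀ ℕ | d.degree = 1} := hm
      rw [← Finsupp.range_single_one] at this
      obtain ⟨k, hk⟩ := this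
      exact ⟨k, hk.symm⟩
    simp [coeff_sum, coeff_X, Finsupp.single_left_inj]
  · rw [hp.coeff_eq_zero hm, coeff_sum]
    symm
    apply Finset.sum_eq_zero
    intro j _
    rw [coeff_smul, coeff_X, if_neg, smul_zero]
    rintro rfl
    simp at hm

theorem aux_lin {K : Type*} [Field K] {n g : ℕ} (c : Fin g → MvPolynomial (Fin n) K)
    (hc : ∀ i, (c i).IsHomogeneous 1) (hli : LinearIndependent K c) :
    IsWeaklyRegular (MvPolynomial (Fin n) K) (List.ofFn c) := by
  let w : Fin g → Fin n → K := fun i j => coeff (Finsupp.single j 1) (c i)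
  let L : (Fin n → K) →ₗ[K] MvPolynomial (Fin n) K := Fintype.linearCombination K X
  have hL : ∀ i, L (w i) = c i := fun i => by
    rw [aux_hom (c i) (hc i)]
    simp [L, w, Fintype.linearCombination_apply]
  have hw : LinearIndependent K w := by
    apply LinearIndependent.of_comp L
    convert hli using 1
    ext1 i
    exact hL i
  let B := Module.Basis.extend hw.linearIndepOn_id
  let f : Fin g → hw.linearIndepOn_id.extend (Set.subset_univ _) := fun i =>
    ⟨w i, hw.linearIndepOn_id.subset_extend _ ⟨i, rfl⟩⟩
  have hfB : ∀ i, B (f i) = w i := fun i => Module.Basis.extend_apply_self _ _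
  have hf : Injective f := fun i j h => hw.injective (congrArg Subtype.val h)
  let e := (SymmetricAlgebra.equivMvPolynomial B).symm.trans
    (SymmetricAlgebra.equivMvPolynomial (Pi.basisFun K (Fin n)))
  have he : ∀ i, e (X (f i)) = c i := by
    intro i
    simp only [e, AlgEquiv.trans_apply, SymmetricAlgebra.equivMvPolynomial_symm_X, hfB]
    rw [← hL]
    have : (SymmetricAlgebra.equivMvPolynomial (Pi.basisFun K (Fin n))).toLinearMap ∘ₗ
        SymmetricAlgebra.ι K _ = L := by
      apply (Pi.basisFun K (Fin n)).ext
      intro j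
      rw [LinearMap.comp_apply]
      erw [SymmetricAlgebra.equivMvPolynomial_ι_apply]
      simp [L]
    exact LinearMap.congr_fun this (w i)
  refine (AddEquiv.isWeaklyRegular_congr (e := e.toRingEquiv.toAddEquiv) ?_).1 (aux_X (K := K) f hf)
  rw [List.forall₂_iff_get]
  refine ⟨by simp, ?_⟩
  intro i h1 h2 x
  have := he ⟨i, by simpa using h1⟩
  simp only [List.get_eq_getElem, List.getElem_ofFn, smul_eq_mul, ← this]
  exact map_mul e _ _

theorem aux_height {R : Type*} [CommRing R] [IsNoetherianRing R] (rs : List R)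
    (h : IsWeaklyRegular R rs) (P : Ideal R) [P.IsPrime] (hP : ∀ r ∈ rs, r ∈ P) :
    (rs.length : ℕ∞) ≤ P.height := by
  induction rs using List.reverseRecOn generalizing P with
  | nil => simp
  | append_singleton rs r ih =>
    rw [isWeaklyRegular_append_iff, isWeaklyRegular_singleton_iff,
      isSMulRegular_quotient_iff_mem_of_smul_mem] at h
    have hle : Ideal.ofList rs ≤ P := Ideal.span_le.2 fun x hx => hP x (by simp at hx; simp [hx])
    obtain ⟨Q, hQ, hQP⟩ := Ideal.exists_minimalPrimes_le hle
    have := hQ.isPrime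
    have hr : r ∉ Q := by
      intro hr
      obtain ⟨y, hy, hy'⟩ := Ideal.exists_mul_mem_of_mem_minimalPrimes hQ hr
      apply hy
      simpa using h.2 y (by simpa using hy')
    have hlt : Q < P := lt_of_le_of_ne hQP (by rintro rfl; exact hr (hP r (by simp)))
    have h1 := Ideal.height_strict_mono_of_isPrime_of_isPrime hlt
    have h2 := ih h.1 Q (fun x hx => hQ.1.2 (Ideal.subset_span hx))
    rw [List.length_append, List.length_singleton]
    push_cast
    exact Order.add_one_le_of_lt (h2.trans_lt h1)

theorem stmt3 {K : Type*} [Field K] {n g : ℕ} (hgn : g ≤ n)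
    (ℓ : Fin g → MvPolynomial (Fin n) K) (hℓ : ∀ i, (ℓ i).IsHomogeneous 1) :
    RingTheory.Sequence.IsRegular (MvPolynomial (Fin n) K)
        (List.ofFn fun i => X (Fin.castLE hgn i) * ℓ i) ↔
      ∀ A : Set (Fin g),
        Module.finrank K ↥(Submodule.span K
          ((fun i => (X (Fin.castLE hgn i) : MvPolynomial (Fin n) K)) '' A ∪ ℓ '' Aᶜ)) = g := by
  classical
  have hrange : ∀ A : Set (Fin g),
      ((fun i => (X (Fin.castLE hgn i) : MvPolynomial (Fin n) K)) '' A ∪ ℓ '' Aᶜ) =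
      Set.range fun i => if i ∈ A then (X (Fin.castLE hgn i) : MvPolynomial (Fin n) K) else ℓ i := by
    intro A
    ext p
    simp only [Set.mem_union, Set.mem_image, Set.mem_range, Set.mem_compl_iff]
    constructor
    · rintro (⟨i, hi, rfl⟩ | ⟨i, hi, rfl⟩)
      · exact ⟨i, by simp [hi]⟩
      · exact ⟨i, by simp [hi]⟩
    · rintro ⟨i, rfl⟩
      by_cases hi : i ∈ A
      · exact Or.inl ⟨i, hi, by simp [hi]⟩
      · exact Or.inr ⟨i, hi, by simp [hi]⟩
  have hXh : ∀ i : Fin n, (X i : MvPolynomial (Fin n) K).IsHomogeneous 1 :=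
    fun i => isHomogeneous_X K i
  have hcc : ∀ p : MvPolynomial (Fin n) K, p.IsHomogeneous 1 → constantCoeff p = 0 := by
    intro p hp
    exact hp.coeff_eq_zero (by simp)
  constructor
  · intro h A
    rw [hrange]
    set c : Fin g → MvPolynomial (Fin n) K :=
      fun i => if i ∈ A then (X (Fin.castLE hgn i) : MvPolynomial (Fin n) K) else ℓ i with hc
    have hch : ∀ i, (c i).IsHomogeneous 1 := by
      intro i
      by_cases hi : i ∈ A
      · simpa [hc, hi] using hXh _
      · simpa [hc, hi] using hℓ i
    apply le_antisymm
    · simpa [Set.finrank] using finrank_range_le_card (R := K) c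
    have : Module.Finite K (Submodule.span K (Set.range c)) :=
      Module.Finite.span_of_finite K (Set.finite_range c)
    obtain ⟨t, hts, htc, htspan, -⟩ := Submodule.exists_finset_span_eq_linearIndepOn K (Set.range c)
    have hle : Ideal.span (t : Set (MvPolynomial (Fin n) K)) ≤ RingHom.ker constantCoeff := by
      rw [Ideal.span_le]
      intro x hx
      obtain ⟨i, rfl⟩ := hts hx
      exact hcc _ (hch i)
    have : (RingHom.ker (constantCoeff : MvPolynomial (Fin n) K →+* K)).IsPrime :=
      RingHom.ker_isPrime _
    obtain ⟨P, hP, -⟩ := Ideal.exists_minimalPrimes_le hle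
    have := hP.isPrime
    have h1 := Ideal.height_le_card_of_mem_minimalPrimes_span_finset hP
    have hcP : ∀ i, c i ∈ P := by
      intro i
      apply hP.1.2
      have : c i ∈ Submodule.span K (t : Set (MvPolynomial (Fin n) K)) := by
        rw [htspan]; exact Submodule.subset_span ⟨i, rfl⟩
      exact Submodule.span_le_restrictScalars K (MvPolynomial (Fin n) K) _ this
    have h2 := aux_height _ h.toIsWeaklyRegular P (by
      intro r hr
      rw [List.mem_ofFn] at hr
      obtain ⟨i, rfl⟩ := hr
      have := hcP i
      by_cases hi : i ∈ A
      · exact P.mul_mem_right _ (by simpa [hc, hi] using this)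
      · exact P.mul_mem_left _ (by simpa [hc, hi] using this))
    have h3 := h2.trans h1
    rw [htc, List.length_ofFn] at h3
    exact_mod_cast h3
  · intro h
    constructor
    · apply aux_prod
      intro c hc
      have hc' : c = fun i => if i ∈ {i | c i = X (Fin.castLE hgn i)} then
          (X (Fin.castLE hgn i) : MvPolynomial (Fin n) K) else ℓ i := by
        ext1 i
        by_cases hi : c i = X (Fin.castLE hgn i)
        · simp [hi]
        · simpa [hi] using hc i
      apply aux_lin
      · intro i
        rcases hc i with hi | hi
        · rw [hi]; exact hXh _
        · rw [hi]; exact hℓ i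
      · rw [linearIndependent_iff_card_eq_finrank_span]
        have := h {i | c i = X (Fin.castLE hgn i)}
        rw [hrange] at this
        rw [Fintype.card_fin, Set.finrank]
        refine this.symm.trans ?_
        refine congrArg (fun d : Fin g → MvPolynomial (Fin n) K =>
          Module.finrank K (Submodule.span K (Set.range d))) ?_
        refine Eq.trans ?_ hc'.symm
        funext i
        congr
    · intro h0
      have hle : Ideal.ofList (List.ofFn fun i => X (Fin.castLE hgn i) * ℓ i) ≤
          RingHom.ker (constantCoeff : MvPolynomial (Fin n) K →+* K) := by
        refine Ideal.span_le.2 ?_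
        intro x hx
        simp only [Set.mem_ofPred_eq, List.mem_ofFn] at hx
        obtain ⟨i, rfl⟩ := hx
        simp [RingHom.mem_ker]
      have h1 : (1 : MvPolynomial (Fin n) K) ∈ (⊤ : Ideal (MvPolynomial (Fin n) K)) := trivial
      rw [h0] at h1
      simp only [smul_eq_mul, Ideal.mul_top] at h1
      have := hle h1
      simp [RingHom.mem_ker] at this
end

section
/- Let K be a field, S = K[x_1,...,x_n], g ≤ n, and let ℓ_1,...,ℓ_g be linear forms such that for every subset A ⊆ {1,...,g} the span of {x_i : i ∈ A} ∪ {ℓ_j : j ∉ A} has dimension g. Then the quotient ring S/(x_1ℓ_1,...,x_gℓ_g) has Krull dimension at most n − g; consequently (x_1ℓ_1,...,x_gℓ_g) is a complete intersection of height g. -/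
open MvPolynomial

theorem aux_chain {α : Type*} [Preorder α] (q : LTSeries α) (k : ℕ) :
    ∀ hk : k < q.length + 1, Order.height q.head + k ≤ Order.height (q ⟨k, hk⟩) := by
  induction k with
  | zero => intro hk; rw [Nat.cast_zero, add_zero]; exact le_rfl
  | succ k ih =>
    intro hk
    have h1 := ih (by omega)
    have h2 : q ⟨k, by omega⟩ < q ⟨k + 1, hk⟩ := q.strictMono (by simp)
    have h3 := Order.height_add_one_le h2
    push_cast
    rw [← add_assoc]
    exact (add_le_add_left h1 1).trans h3

theorem aux_aeval_lin {K : Type*} [Field K] {n : ℕ}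
    (π : MvPolynomial (Fin n) K →ₗ[K] MvPolynomial (Fin n) K)
    (v : MvPolynomial (Fin n) K) (hv : v.IsHomogeneous 1) :
    aeval (fun i => π (X i)) v = π v := by
  have h : v ∈ Submodule.span K (Set.range (X : Fin n → MvPolynomial (Fin n) K)) := by
    rw [← mem_homogeneousSubmodule, homogeneousSubmodule_one_eq_span_X] at hv
    exact hv
  induction h using Submodule.span_induction with
  | mem x hx => obtain ⟨i, rfl⟩ := hx; simp
  | zero => simp
  | add x y _ _ hx hy =>
    simp only [map_add]
    rw [hx, hy]
    all_goals
      rw [← mem_homogeneousSubmodule, homogeneousSubmodule_one_eq_span_X]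
      assumption
  | smul a x _ hx =>
    simp only [map_smul]
    rw [hx]
    rw [← mem_homogeneousSubmodule, homogeneousSubmodule_one_eq_span_X]
    assumption

theorem aux_prime {K : Type*} [Field K] {n : ℕ}
    (V : Submodule K (MvPolynomial (Fin n) K)) :
    ∃ Q : Ideal (MvPolynomial (Fin n) K), Q.IsPrime ∧ Q ≤ Ideal.span (V : Set _) ∧
      ∀ v : MvPolynomial (Fin n) K, v.IsHomogeneous 1 → (v ∈ Q ↔ v ∈ V) := by
  obtain ⟨s, hs⟩ := V.mkQ.exists_rightInverse_of_surjective (by simp)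
  have hs' : ∀ y, V.mkQ (s y) = y := fun y => LinearMap.congr_fun hs y
  let π := s ∘ₗ V.mkQ
  let φ : MvPolynomial (Fin n) K →ₐ[K] MvPolynomial (Fin n) K := aeval (fun i => π (X i))
  refine ⟨RingHom.ker φ, RingHom.ker_isPrime _, ?_, ?_⟩
  · have hπ : ∀ x, x - π x ∈ V := by
      intro x
      rw [← Submodule.Quotient.mk_eq_zero, ← Submodule.mkQ_apply, map_sub]
      simp only [π, LinearMap.comp_apply, hs', sub_self]
    have key : (Ideal.Quotient.mkₐ K (Ideal.span (V : Set (MvPolynomial (Fin n) K)))).comp φ =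
        Ideal.Quotient.mkₐ K (Ideal.span (V : Set (MvPolynomial (Fin n) K))) := by
      apply MvPolynomial.algHom_ext
      intro i
      simp only [AlgHom.comp_apply, φ, aeval_X, Ideal.Quotient.mkₐ_eq_mk]
      symm
      exact Ideal.Quotient.eq.2 (Ideal.subset_span (hπ _))
    intro f hf
    have := DFunLike.congr_fun key f
    rw [RingHom.mem_ker] at hf
    rw [AlgHom.comp_apply, hf, map_zero] at this
    exact Ideal.Quotient.eq_zero_iff_mem.1 this.symm
  · intro v hv
    rw [RingHom.mem_ker]
    change aeval (fun i => π (X i)) v = 0 ↔ _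
    rw [aux_aeval_lin π v hv, ← Submodule.Quotient.mk_eq_zero V, ← Submodule.mkQ_apply]
    constructor
    · intro h
      rw [← hs' (V.mkQ v)]
      change V.mkQ (π v) = 0
      rw [h, map_zero]
    · intro h
      simp only [π, LinearMap.comp_apply, h, map_zero]

theorem aux_height_s4 {K : Type*} [Field K] {n : ℕ} (k : ℕ) :
    ∀ (b : Fin k → MvPolynomial (Fin n) K), LinearIndependent K b →
      (∀ i, (b i).IsHomogeneous 1) →
      ∀ P : PrimeSpectrum (MvPolynomial (Fin n) K), (∀ i, b i ∈ P.asIdeal) →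
        (k : ℕ∞) ≤ Order.height P := by
  induction k with
  | zero => intros; simp
  | succ k ih =>
    intro b hb hh P hP
    obtain ⟨Q, hQ, hle, hmem⟩ :=
      aux_prime (Submodule.span K (Set.range (fun i : Fin k => b i.castSucc)))
    have h1 := ih (fun i => b i.castSucc) (hb.comp _ (Fin.castSucc_injective k))
      (fun i => hh _) ⟨Q, hQ⟩ (fun i => (hmem _ (hh _)).2 (Submodule.subset_span ⟨i, rfl⟩))
    have hlt : (⟨Q, hQ⟩ : PrimeSpectrum (MvPolynomial (Fin n) K)) < P := by
      rw [← PrimeSpectrum.asIdeal_lt_asIdeal]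
      refine lt_of_le_of_ne (hle.trans ?_) ?_
      · rw [Ideal.span_le]
        have : Submodule.span K (Set.range (fun i : Fin k => b i.castSucc)) ≤
            P.asIdeal.restrictScalars K := by
          rw [Submodule.span_le]
          rintro _ ⟨i, rfl⟩
          exact hP _
        exact this
      · intro h
        have h2 : b (Fin.last k) ∈ Q := by
          change Q = P.asIdeal at h
          rw [h]; exact hP _
        rw [hmem _ (hh _)] at h2
        have h3 := hb.notMem_span_image (s := Set.range Fin.castSucc) (x := Fin.last k) (by
          rintro ⟨i, hi⟩
          exact (Fin.castSucc_lt_last i).ne hi)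
        apply h3
        rw [← Set.range_comp]
        exact h2
    have h4 := Order.height_add_one_le hlt
    push_cast
    exact (add_le_add_left h1 1).trans h4

theorem aux_main {K : Type*} [Field K] {n g : ℕ} (hgn : g ≤ n)
    (ℓ : Fin g → MvPolynomial (Fin n) K) (hℓ : ∀ i, (ℓ i).IsHomogeneous 1)
    (hdim : ∀ A : Set (Fin g),
      Module.finrank K ↥(Submodule.span K
        ((fun i => (X (Fin.castLE hgn i) : MvPolynomial (Fin n) K)) '' A ∪ ℓ '' Aᶜ)) = g)
    (P : PrimeSpectrum (MvPolynomial (Fin n) K))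
    (hP : Ideal.span (Set.range fun i : Fin g =>
        (X (Fin.castLE hgn i) : MvPolynomial (Fin n) K) * ℓ i) ≤ P.asIdeal) :
    (g : ℕ∞) ≤ Order.height P := by
  let A : Set (Fin g) := {i | (X (Fin.castLE hgn i) : MvPolynomial (Fin n) K) ∈ P.asIdeal}
  have hA := hdim A
  set T := ((fun i => (X (Fin.castLE hgn i) : MvPolynomial (Fin n) K)) '' A ∪ ℓ '' Aᶜ) with hT
  have hfin : T.Finite := (Set.toFinite _).union (Set.toFinite _)
  have : FiniteDimensional K (Submodule.span K T) := FiniteDimensional.span_of_finite K hfin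
  let b := Module.finBasisOfFinrankEq K (Submodule.span K T) hA
  have e1 : Submodule.span K T ≤ homogeneousSubmodule (Fin n) K 1 := by
    rw [Submodule.span_le]
    rintro _ (⟨i, _, rfl⟩ | ⟨i, _, rfl⟩)
    · exact isHomogeneous_X _ _
    · exact hℓ i
  have e2 : Submodule.span K T ≤ P.asIdeal.restrictScalars K := by
    rw [Submodule.span_le]
    rintro _ (⟨i, hi, rfl⟩ | ⟨i, hi, rfl⟩)
    · exact hi
    · exact (P.isPrime.mem_or_mem (hP (Ideal.subset_span ⟨i, rfl⟩))).resolve_left hi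
  exact aux_height_s4 g (fun i => (b i : MvPolynomial (Fin n) K))
    (b.linearIndependent.map' (Submodule.subtype _) (Submodule.ker_subtype _))
    (fun i => e1 (b i).2) P (fun i => e2 (b i).2)

theorem aux_upper {R : Type*} [CommRing R] [IsNoetherianRing R] {g : ℕ} (f : Fin g → R)
    (hne : Ideal.span (Set.range f) ≠ ⊤) : idealHeight (Ideal.span (Set.range f)) ≤ g := by
  obtain ⟨p, hp⟩ := Ideal.nonempty_minimalPrimes hne
  have hpp : p.IsPrime := hp.1.1
  have h1 := Ideal.height_le_spanRank_toENat_of_mem_minimalPrimes _ p hp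
  have h2 : Order.height (⟨p, hpp⟩ : PrimeSpectrum R) ≤ g := by
    rw [← PrimeSpectrum.height_eq_orderHeight]
    refine h1.trans ?_
    have h3 := Submodule.spanRank_span_le_card (R := R) (Set.range f)
    refine (Cardinal.toENat.monotone' h3).trans ?_
    change (Set.range f).encard ≤ g
    rw [← Set.image_univ]
    refine (Set.encard_image_le _ _).trans ?_
    simp
  refine le_trans ?_ h2
  exact iInf_le (fun P : {P : PrimeSpectrum R // Ideal.span (Set.range f) ≤ P.asIdeal} =>
    Order.height P.val) ⟨⟨p, hpp⟩, hp.1.2⟩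

theorem stmt4 {K : Type*} [Field K] {n g : ℕ} (hgn : g ≤ n)
    (ℓ : Fin g → MvPolynomial (Fin n) K) (hℓ : ∀ i, (ℓ i).IsHomogeneous 1)
    (hdim : ∀ A : Set (Fin g),
      Module.finrank K ↥(Submodule.span K
        ((fun i => (X (Fin.castLE hgn i) : MvPolynomial (Fin n) K)) '' A ∪ ℓ '' Aᶜ)) = g) :
    ringKrullDim (MvPolynomial (Fin n) K ⧸
        Ideal.span (Set.range fun i : Fin g => X (Fin.castLE hgn i) * ℓ i)) ≤ (n - g : ℕ) ∧
    idealHeight (Ideal.span (Set.range fun i : Fin g =>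
        (X (Fin.castLE hgn i) : MvPolynomial (Fin n) K) * ℓ i)) = (g : ℕ∞) := by
  have key := aux_main hgn ℓ hℓ hdim
  set I := Ideal.span (Set.range fun i : Fin g =>
        (X (Fin.castLE hgn i) : MvPolynomial (Fin n) K) * ℓ i) with hI
  constructor
  · rw [ringKrullDim_quotient]
    refine iSup_le fun p => ?_
    have hn : ringKrullDim (MvPolynomial (Fin n) K) = n := by
      rw [MvPolynomial.ringKrullDim_of_isNoetherianRing]; simp
    let q : LTSeries (PrimeSpectrum (MvPolynomial (Fin n) K)) :=
      p.map Subtype.val (fun _ _ h => h)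
    have h1 : (g : ℕ∞) ≤ Order.height q.head := key _ p.head.2
    have h2 : Order.height q.head + q.length ≤ Order.height q.last :=
      aux_chain q q.length (by omega)
    have h3 : ((Order.height q.last : ℕ∞) : WithBot ℕ∞) ≤ n := by
      rw [← hn]; exact Order.height_le_krullDim _
    have h4 : (g : ℕ∞) + q.length ≤ n := by
      refine (add_le_add_left h1 _).trans (h2.trans ?_)
      exact_mod_cast h3
    have h5 : g + p.length ≤ n := by exact_mod_cast h4
    have h6 : p.length ≤ n - g := by omega
    exact_mod_cast h6
  · apply le_antisymm
    · have hne : I ≠ ⊤ := by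
        have : I ≤ RingHom.ker (constantCoeff (R := K) (σ := Fin n)) := by
          rw [hI, Ideal.span_le]
          rintro _ ⟨i, rfl⟩
          simp [RingHom.mem_ker]
        intro h
        rw [h] at this
        exact RingHom.ker_ne_top _ (top_le_iff.1 this)
      exact aux_upper _ hne
    · exact le_iInf fun P => key P.1 P.2
end

section
/- Let K be a field and I ⊆ S = K[x_1,...,x_n] a monomial ideal generated in degree 2 of height g such that (x_1,...,x_g) is a minimal prime of I. Write the degree-2 component of I as I_2 = x_1V_1 ⊕ ... ⊕ x_gV_g, where each V_i is the K-vector space spanned by the variables x_j with x_ix_j ∈ I. Then for every subset A ⊆ {1,...,g}, the K-vector space Σ_{i∈A} V_i + Σ_{j∈{1,...,g}\A} ⟨x_j⟩ has dimension at least g. -/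
open MvPolynomial

/-- `Vspace hgn I i` is the linear span of the variables `x_j` such that `x_i * x_j ∈ I`. -/
noncomputable def Vspace {K : Type*} [Field K] {n g : ℕ} (hgn : g ≤ n)
    (I : Ideal (MvPolynomial (Fin n) K)) (i : Fin g) : Submodule K (MvPolynomial (Fin n) K) :=
  Submodule.span K {p | ∃ j : Fin n, X (Fin.castLE hgn i) * X j ∈ I ∧ p = X j}

theorem stmt5 {K : Type*} [Field K] {n g : ℕ} (hgn : g ≤ n)
    (I : Ideal (MvPolynomial (Fin n) K))
    (hmon : IsQuadraticMonomialIdeal I) (hht : idealHeight I = (g : ℕ∞))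
    (hmin : Ideal.span (Set.range fun i : Fin g =>
      (X (Fin.castLE hgn i) : MvPolynomial (Fin n) K)) ∈ I.minimalPrimes) :
    ∀ A : Set (Fin g),
      (g : ℕ) ≤ Module.finrank K ↥((⨆ i ∈ A, Vspace hgn I i) ⊔
        Submodule.span K {p | ∃ j ∈ Aᶜ, p = (X (Fin.castLE hgn j) : MvPolynomial (Fin n) K)}) := by
  classical
  intro A
  obtain ⟨E, hE⟩ := hmon
  set W : Set (Fin n) := {j | (∃ i ∈ A, (X (Fin.castLE hgn i) * X j : MvPolynomial (Fin n) K) ∈ I) ∨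
    ∃ i ∈ Aᶜ, j = Fin.castLE hgn i} with hW
  have hprime := hmin.1.1
  have hle := hmin.1.2
  have hspan : ((⨆ i ∈ A, Vspace hgn I i) ⊔
        Submodule.span K {p | ∃ j ∈ Aᶜ, p = (X (Fin.castLE hgn j) : MvPolynomial (Fin n) K)})
      = Submodule.span K (X '' W) := by
    apply le_antisymm
    · refine sup_le (iSup₂_le fun i hi => ?_) ?_
      · refine Submodule.span_mono ?_
        rintro p ⟨j, hj, rfl⟩
        exact ⟨j, Or.inl ⟨i, hi, hj⟩, rfl⟩
      · refine Submodule.span_mono ?_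
        rintro p ⟨j, hj, rfl⟩
        exact ⟨_, Or.inr ⟨j, hj, rfl⟩, rfl⟩
    · rw [Submodule.span_le]
      rintro _ ⟨j, ⟨i, hi, hj⟩ | ⟨i, hi, rfl⟩, rfl⟩
      · exact (le_sup_of_le_left (le_iSup₂_of_le (f := fun i _ => Vspace hgn I i) i hi le_rfl) :
          Vspace hgn I i ≤ _) (Submodule.subset_span ⟨j, hj, rfl⟩)
      · exact Submodule.mem_sup_right (Submodule.subset_span ⟨i, hi, rfl⟩)
  have hvar : ∀ a : Fin n, (X a : MvPolynomial (Fin n) K) ∈ Ideal.span (Set.range fun i : Fin g =>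
      (X (Fin.castLE hgn i) : MvPolynomial (Fin n) K)) → ∃ i, a = Fin.castLE hgn i := by
    intro a ha
    have : (Set.range fun i : Fin g => (X (Fin.castLE hgn i) : MvPolynomial (Fin n) K))
        = X '' (Set.range (Fin.castLE hgn)) := by
      rw [← Set.range_comp]; rfl
    rw [this, mem_ideal_span_X_image] at ha
    obtain ⟨i, ⟨k, rfl⟩, hi⟩ := ha (Finsupp.single a 1) (by simp [X, support_monomial])
    refine ⟨k, ?_⟩
    by_contra h
    exact hi (Finsupp.single_eq_of_ne (Ne.symm h))
  have hIW : I ≤ Ideal.span (X '' W) := by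
    have key : ∀ a b : Fin n, (X a * X b : MvPolynomial (Fin n) K) ∈ I →
        (∃ i, a = Fin.castLE hgn i) →
        (X a * X b : MvPolynomial (Fin n) K) ∈ Ideal.span (X '' W) := by
      rintro _ b hab ⟨i, rfl⟩
      by_cases hi : i ∈ A
      · exact Ideal.mul_mem_left _ _ (Ideal.subset_span ⟨b, Or.inl ⟨i, hi, hab⟩, rfl⟩)
      · exact Ideal.mul_mem_right _ _ (Ideal.subset_span ⟨_, Or.inr ⟨i, hi, rfl⟩, rfl⟩)
    conv_lhs => rw [hE]
    rw [Ideal.span_le]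
    rintro _ ⟨⟨a, b⟩, he, rfl⟩
    have hab : (X a * X b : MvPolynomial (Fin n) K) ∈ I := by
      rw [hE]; exact Ideal.subset_span ⟨(a, b), he, rfl⟩
    rcases hprime.mem_or_mem (hle hab) with h | h
    · exact key a b hab (hvar a h)
    · have := key b a (by rwa [mul_comm]) (hvar b h)
      rw [mul_comm] at this
      exact this
  have hne : Ideal.span (X '' W : Set (MvPolynomial (Fin n) K)) ≠ ⊤ := by
    rw [Ne, Ideal.eq_top_iff_one, mem_ideal_span_X_image]
    intro h
    obtain ⟨i, _, hi⟩ := h 0 (by simp)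
    exact hi rfl
  obtain ⟨P, hP⟩ := Ideal.nonempty_minimalPrimes hne
  have hPp := hP.1.1
  set F : Finset (MvPolynomial (Fin n) K) := W.toFinset.image X with hF
  have hFW : (F : Set (MvPolynomial (Fin n) K)) = X '' W := by simp [hF]
  have h1 : (g : ℕ∞) ≤ P.height := by
    rw [← hht]
    refine (iInf_le _ ⟨⟨P, hPp⟩, hIW.trans hP.1.2⟩).trans ?_
    exact (PrimeSpectrum.height_eq_orderHeight ⟨P, hPp⟩).ge
  have h2 : P.height ≤ F.card :=
    Ideal.height_le_card_of_mem_minimalPrimes_span_finset (by rw [hFW]; exact hP)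
  rw [hspan, ← hFW, finrank_span_finset_eq_card]
  · exact_mod_cast h1.trans h2
  · rw [hFW]
    exact ((linearIndependent_X (Fin n) K).linearIndepOn W).id_image
end

section
/- Let K be a field and I ⊆ S = K[x_1,...,x_n] a monomial ideal generated in degree 2 of height g such that (x_1,...,x_g) is a minimal prime of I, and write I_2 = x_1V_1 ⊕ ... ⊕ x_gV_g with each V_i spanned by variables. Then for every subset A ⊆ {1,...,g} there exist variables x_{i_j} ∈ V_j for each j ∈ A such that the K-vector space spanned by {x_{i_j} : j ∈ A} ∪ {x_j : j ∈ {1,...,g} \ A} has dimension g. -/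
open MvPolynomial

theorem height_cover {K : Type*} [Field K] {n : ℕ} (I : Ideal (MvPolynomial (Fin n) K))
    (C : Finset (Fin n)) (h : I ≤ Ideal.span ((X : Fin n → MvPolynomial (Fin n) K) '' (C : Set (Fin n)))) :
    idealHeight I ≤ (C.card : ℕ∞) := by
  have hne : Ideal.span ((X : Fin n → MvPolynomial (Fin n) K) '' (C : Set (Fin n))) ≠ ⊤ := by
    intro htop
    have hle : Ideal.span ((X : Fin n → MvPolynomial (Fin n) K) '' (C : Set (Fin n))) ≤
        RingHom.ker (constantCoeff : MvPolynomial (Fin n) K →+* K) := by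
      rw [Ideal.span_le]
      rintro _ ⟨i, _, rfl⟩
      simp [RingHom.mem_ker]
    rw [htop] at hle
    have h1 := hle (Submodule.mem_top : (1 : MvPolynomial (Fin n) K) ∈ _)
    simp [RingHom.mem_ker] at h1
  obtain ⟨p, hp⟩ := Ideal.nonempty_minimalPrimes hne
  have hpp : p.IsPrime := hp.1.1
  have h2 := Ideal.height_le_card_of_mem_minimalPrimes_span (C.finite_toSet.image _) hp
  have h3 : idealHeight I ≤ p.height := by
    rw [show p.height = _ from PrimeSpectrum.height_eq_orderHeight ⟨p, hpp⟩]
    exact iInf_le (fun P : {P : PrimeSpectrum (MvPolynomial (Fin n) K) // I ≤ P.asIdeal} =>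
      Order.height P.val) ⟨⟨p, hpp⟩, h.trans hp.1.2⟩
  refine h3.trans (h2.trans ?_)
  have := Set.ncard_image_le (f := (X : Fin n → MvPolynomial (Fin n) K)) C.finite_toSet
  rw [Set.ncard_coe_finset] at this
  exact_mod_cast this

theorem stmt6 {K : Type*} [Field K] {n g : ℕ} (hgn : g ≤ n)
    (I : Ideal (MvPolynomial (Fin n) K))
    (hmon : IsQuadraticMonomialIdeal I) (hht : idealHeight I = (g : ℕ∞))
    (hmin : Ideal.span (Set.range fun i : Fin g =>
      (X (Fin.castLE hgn i) : MvPolynomial (Fin n) K)) ∈ I.minimalPrimes) :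
    ∀ A : Set (Fin g), ∃ c : Fin g → Fin n,
      (∀ j ∈ A, (X (c j) : MvPolynomial (Fin n) K) ∈ Vspace hgn I j) ∧
      Module.finrank K ↥(Submodule.span K
        ({p | ∃ j ∈ A, p = (X (c j) : MvPolynomial (Fin n) K)} ∪
          {p | ∃ j ∈ Aᶜ, p = (X (Fin.castLE hgn j) : MvPolynomial (Fin n) K)})) = g := by
  classical
  intro A
  obtain ⟨E, hE⟩ := hmon
  let t : Fin g → Finset (Fin n) := fun j =>
    if j ∈ A then Finset.univ.filter
      (fun k => (X (Fin.castLE hgn j) * X k : MvPolynomial (Fin n) K) ∈ I) else {Fin.castLE hgn j}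
  have hrange : ∀ k : Fin n, (X k : MvPolynomial (Fin n) K) ∈ Ideal.span (Set.range fun i : Fin g =>
      (X (Fin.castLE hgn i) : MvPolynomial (Fin n) K)) → ∃ i : Fin g, Fin.castLE hgn i = k := by
    intro k hk
    have he : (Set.range fun i : Fin g => (X (Fin.castLE hgn i) : MvPolynomial (Fin n) K)) =
        X '' (Set.range (Fin.castLE hgn)) := by
      rw [← Set.range_comp]; rfl
    rw [he, mem_ideal_span_X_image] at hk
    obtain ⟨i, ⟨j, rfl⟩, hi⟩ := hk (Finsupp.single k 1) (by simp [X, support_monomial])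
    refine ⟨j, ?_⟩
    by_contra hne
    exact hi (by rw [Finsupp.single_apply, if_neg (fun h => hne h.symm)])
  have hall : ∀ s : Finset (Fin g), s.card ≤ (s.biUnion t).card := by
    intro s
    let C : Finset (Fin n) := s.biUnion t ∪ sᶜ.image (Fin.castLE hgn)
    have hkey : ∀ (i : Fin g) (k : Fin n), (X (Fin.castLE hgn i) * X k : MvPolynomial (Fin n) K) ∈ I →
        Fin.castLE hgn i ∈ C ∨ k ∈ C := by
      intro i k hik
      by_cases his : i ∈ s
      · by_cases hiA : i ∈ A
        · right
          exact Finset.mem_union_left _ (Finset.mem_biUnion.2 ⟨i, his, by simp [t, hiA, hik]⟩)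
        · left
          exact Finset.mem_union_left _ (Finset.mem_biUnion.2 ⟨i, his, by simp [t, hiA]⟩)
      · left
        exact Finset.mem_union_right _ (Finset.mem_image_of_mem _ (by simpa using his))
    have hcov : I ≤ Ideal.span ((X : Fin n → MvPolynomial (Fin n) K) '' (C : Set (Fin n))) := by
      have hmem : ∀ k ∈ C, (X k : MvPolynomial (Fin n) K) ∈
          Ideal.span ((X : Fin n → MvPolynomial (Fin n) K) '' (C : Set (Fin n))) :=
        fun k hk => Ideal.subset_span ⟨k, hk, rfl⟩
      have hEI : ∀ e ∈ E, (X e.1 * X e.2 : MvPolynomial (Fin n) K) ∈ I := by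
        intro e he
        rw [hE]
        exact Ideal.subset_span ⟨e, he, rfl⟩
      conv_lhs => rw [hE]
      rw [Ideal.span_le]
      rintro _ ⟨e, he, rfl⟩
      have heI := hEI e he
      have : e.1 ∈ C ∨ e.2 ∈ C := by
        rcases hmin.1.1.mem_or_mem (hmin.1.2 heI) with h | h
        · obtain ⟨i, hi⟩ := hrange _ h
          rw [← hi] at heI ⊢
          exact hkey i _ heI
        · obtain ⟨i, hi⟩ := hrange _ h
          rw [← hi, mul_comm] at heI
          rw [← hi]
          exact (hkey i _ heI).symm
      rcases this with h | h
      · exact Ideal.mul_mem_right _ _ (hmem _ h)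
      · exact Ideal.mul_mem_left _ _ (hmem _ h)
    have h1 := height_cover I C hcov
    rw [hht] at h1
    have h2 : g ≤ C.card := by exact_mod_cast h1
    have h3 : C.card ≤ _ := Finset.card_union_le _ _
    have h4 : (sᶜ.image (Fin.castLE hgn)).card ≤ _ := Finset.card_image_le
    have h5 := Finset.card_add_card_compl s
    rw [Fintype.card_fin] at h5
    omega
  obtain ⟨c, hinj, hc⟩ := (Finset.all_card_le_biUnion_card_iff_exists_injective t).mp hall
  refine ⟨c, ?_, ?_⟩
  · intro j hj
    have := hc j
    simp only [t, if_pos hj, Finset.mem_filter, Finset.mem_univ, true_and] at this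
    exact Submodule.subset_span ⟨c j, this, rfl⟩
  · have hset : ({p | ∃ j ∈ A, p = (X (c j) : MvPolynomial (Fin n) K)} ∪
          {p | ∃ j ∈ Aᶜ, p = (X (Fin.castLE hgn j) : MvPolynomial (Fin n) K)}) =
        Set.range (fun j => (X (c j) : MvPolynomial (Fin n) K)) := by
      have hcA : ∀ j, j ∉ A → c j = Fin.castLE hgn j := by
        intro j hj
        have := hc j
        simpa [t, if_neg hj] using this
      ext p
      constructor
      · rintro (⟨j, hj, rfl⟩ | ⟨j, hj, rfl⟩)
        · exact ⟨j, rfl⟩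
        · exact ⟨j, by simp only [hcA j hj]⟩
      · rintro ⟨j, rfl⟩
        by_cases hj : j ∈ A
        · exact Or.inl ⟨j, hj, rfl⟩
        · exact Or.inr ⟨j, hj, by simp only [hcA j hj]⟩
    rw [hset]
    have hli : LinearIndependent K (fun j => (X (c j) : MvPolynomial (Fin n) K)) :=
      (linearIndependent_X (Fin n) K).comp c hinj
    rw [finrank_span_eq_card hli, Fintype.card_fin]
end
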